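/- arXiv:1503.07245 — 2 statements merged into one kernel-verified Lean document; each statement's English description precedes it below -/
import Mathlib

section
/- In the discrete setup, let α ∈ ℝ^k, let λ ∈ ℝ, and let f : V → ℂ satisfy H^α·f = λ·f, with f(v_j) ≠ 0 and f(u_j) ≠ 0 for every j = 1,…,k. Define γ_j = e^{iα_j}·f(u_j)/f(v_j) (a nonzero complex number) for each j. Then H^γ·f = λ·f, i.e., f is also an eigenvector of the matrix H^γ corresponding to the same eigenvalue λ. -/
open Matrix Complex BigOperators

/-- The magnetic hopping matrix `M^α`: its only nonzero entries are
`M^α_{v_j, u_j} = e^{i α_j}` and `M^α_{u_j, v_j} = e^{-i α_j}`. -/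
noncomputable def magM {V : Type*} [Fintype V] [DecidableEq V] {k : ℕ}
    (v u : Fin k → V) (α : Fin k → ℝ) : Matrix V V ℂ := fun x y =>
  (∑ j, if x = v j ∧ y = u j then Complex.exp (Complex.I * α j) else 0) +
  (∑ j, if x = u j ∧ y = v j then Complex.exp (-(Complex.I * α j)) else 0)

/-- The magnetic discrete Schrödinger operator `H^α = Q - C - M^α` on the fundamental
domain: `Q` is the diagonal potential, `C` the adjacency matrix of `G`. -/
noncomputable def magH {V : Type*} [Fintype V] [DecidableEq V]
    (G : SimpleGraph V) [DecidableRel G.Adj] (q : V → ℝ) {k : ℕ}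
    (v u : Fin k → V) (α : Fin k → ℝ) : Matrix V V ℂ :=
  Matrix.diagonal (fun x => (q x : ℂ)) - G.adjMatrix ℂ - magM v u α

/-- The diagonal matrix `M^γ`: its only nonzero entries are `M^γ_{v_j,v_j} = γ_j` and
`M^γ_{u_j,u_j} = γ_j⁻¹`. -/
noncomputable def robM {V : Type*} [Fintype V] [DecidableEq V] {k : ℕ}
    (v u : Fin k → V) (γ : Fin k → ℂ) : Matrix V V ℂ :=
  Matrix.diagonal (fun x =>
    (∑ j, if x = v j then γ j else 0) + (∑ j, if x = u j then (γ j)⁻¹ else 0))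

/-- The operator `H^γ = Q - C - M^γ`. -/
noncomputable def robH {V : Type*} [Fintype V] [DecidableEq V]
    (G : SimpleGraph V) [DecidableRel G.Adj] (q : V → ℝ) {k : ℕ}
    (v u : Fin k → V) (γ : Fin k → ℂ) : Matrix V V ℂ :=
  Matrix.diagonal (fun x => (q x : ℂ)) - G.adjMatrix ℂ - robM v u γ

/-- **Lemma A.3 (discrete).** If `f` is an eigenvector of `H^α` with eigenvalue `λ` that is
nonzero at every quasi-connected vertex, and `γ_j = e^{iα_j} f(u_j)/f(v_j)`, then `f` is
also an eigenvector of `H^γ` with the same eigenvalue `λ`. -/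
theorem eigenvector_of_robH
    {V : Type*} [Fintype V] [DecidableEq V]
    (G : SimpleGraph V) [DecidableRel G.Adj] (q : V → ℝ) {k : ℕ}
    (v u : Fin k → V)
    (hdist : Function.Injective (Sum.elim v u : Fin k ⊕ Fin k → V))
    (hnoedge : ∀ j, ¬ G.Adj (v j) (u j))
    (α : Fin k → ℝ) (lam : ℝ) (f : V → ℂ)
    (hf : (magH G q v u α).mulVec f = (lam : ℂ) • f)
    (hv : ∀ j, f (v j) ≠ 0) (hu : ∀ j, f (u j) ≠ 0)
    (γ : Fin k → ℂ)
    (hγ : ∀ j, γ j = Complex.exp (Complex.I * α j) * f (u j) / f (v j)) :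
    (robH G q v u γ).mulVec f = (lam : ℂ) • f := by
  have key : (robM v u γ).mulVec f = (magM v u α).mulVec f := by
    funext x
    have h1 : (magM v u α).mulVec f x =
        (∑ j, if x = v j then Complex.exp (Complex.I * α j) * f (u j) else 0) +
        (∑ j, if x = u j then Complex.exp (-(Complex.I * α j)) * f (v j) else 0) := by
      simp only [Matrix.mulVec, dotProduct, magM, add_mul, Finset.sum_add_distrib,
        Finset.sum_mul]
      congr 1
      · rw [Finset.sum_comm]
        refine Finset.sum_congr rfl fun j _ => ?_
        by_cases hx : x = v j <;> simp [hx]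
      · rw [Finset.sum_comm]
        refine Finset.sum_congr rfl fun j _ => ?_
        by_cases hx : x = u j <;> simp [hx]
    rw [h1, robM, Matrix.mulVec_diagonal, add_mul, Finset.sum_mul, Finset.sum_mul]
    congr 1
    · refine Finset.sum_congr rfl fun j _ => ?_
      by_cases hx : x = v j
      · have := hv j
        rw [if_pos hx, if_pos hx, hx, hγ]
        field_simp
      · simp [hx]
    · refine Finset.sum_congr rfl fun j _ => ?_
      by_cases hx : x = u j
      · have := hv j
        have := hu j
        have := Complex.exp_ne_zero (Complex.I * α j)
        rw [if_pos hx, if_pos hx, hx, hγ, Complex.exp_neg]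
        field_simp
      · simp [hx]
  rw [← hf, robH, magH, Matrix.sub_mulVec, Matrix.sub_mulVec _ (magM v u α), key]
end

section
/- In the discrete setup, let λ : ℝ^k → ℝ be a function such that λ(α) is an eigenvalue of H^α for every α ∈ ℝ^k, let α* ∈ ℝ^k, suppose λ is differentiable at α*, suppose the eigenvalue λ(α*) of H^{α*} is simple (its eigenspace over ℂ is one-dimensional), and let f : V → ℂ be a corresponding eigenvector of H^{α*} with unit norm (∑_{x∈V} |f(x)|² = 1). Then for every j = 1,…,k the partial derivative of λ at α* satisfies ∂λ/∂α_j(α*) = 2·Im(e^{iα*_j}·f(u_j)·conj(f(v_j))). -/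
open Matrix Complex BigOperators

open Topology Filter in
theorem hf_general {V : Type*} [Fintype V] [DecidableEq V]
    (A : ℝ → Matrix V V ℂ) (A' : Matrix V V ℂ)
    (hA : ∀ x y, HasDerivAt (fun t => A t x y) (A' x y) 0)
    (l : ℝ → ℝ) (l' : ℝ) (hl : HasDerivAt l l' 0)
    (herm : (A 0).IsHermitian)
    (heig : ∀ t, Module.End.HasEigenvalue (A t).mulVecLin (l t : ℂ))
    (hs : Module.finrank ℂ (Module.End.eigenspace (A 0).mulVecLin (l 0 : ℂ)) = 1)
    (f : V → ℂ) (hf : (A 0).mulVec f = (l 0 : ℂ) • f) (hf0 : f ≠ 0) :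
    star f ⬝ᵥ (A' *ᵥ f) = (l' : ℂ) * (star f ⬝ᵥ f) := by
  have hF : ∀ t, ∃ g : V → ℂ, ‖g‖ = 1 ∧ A t *ᵥ g = (l t : ℂ) • g := by
    intro t
    obtain ⟨g, hg⟩ := (heig t).exists_hasEigenvector
    have hg1 : A t *ᵥ g = (l t : ℂ) • g := hg.apply_eq_smul
    have hg2 : ‖g‖ ≠ 0 := norm_ne_zero_iff.2 hg.2
    refine ⟨((‖g‖⁻¹ : ℝ) : ℂ) • g, ?_, ?_⟩
    · rw [norm_smul, Complex.norm_real, norm_inv, norm_norm, inv_mul_cancel₀ hg2]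
    · rw [Matrix.mulVec_smul, hg1, smul_comm]
  choose F hF1 hF2 using hF
  let U : Ultrafilter ℝ := Ultrafilter.of (𝓝[≠] (0:ℝ))
  have hU : (U : Filter ℝ) ≤ 𝓝[≠] (0:ℝ) := Ultrafilter.of_le _
  have hU' : (U : Filter ℝ) ≤ 𝓝 (0:ℝ) := hU.trans nhdsWithin_le_nhds
  obtain ⟨g, hgS, hg⟩ := (isCompact_sphere (0 : V → ℂ) 1).ultrafilter_le_nhds (U.map F)
    (by
      rw [le_principal_iff]
      exact Filter.mem_map.2 (Filter.univ_mem' (fun t => by simp [hF1])))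
  have hFg : Tendsto F U (𝓝 g) := hg
  have hFx : ∀ x, Tendsto (fun t => F t x) U (𝓝 (g x)) := fun x => (tendsto_pi_nhds.1 hFg) x
  have hlc : Tendsto (fun t => (l t : ℂ)) U (𝓝 (l 0 : ℂ)) :=
    (Complex.continuous_ofReal.tendsto _).comp (hl.continuousAt.tendsto.mono_left hU')
  have hAc : ∀ x y, Tendsto (fun t => A t x y) U (𝓝 (A 0 x y)) := fun x y =>
    (hA x y).continuousAt.tendsto.mono_left hU'
  have hgeig : A 0 *ᵥ g = (l 0 : ℂ) • g := by
    funext x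
    have h1 : Tendsto (fun t => (A t *ᵥ F t) x) U (𝓝 ((A 0 *ᵥ g) x)) := by
      simp only [Matrix.mulVec, dotProduct]
      exact tendsto_finsetSum _ (fun y _ => (hAc x y).mul (hFx y))
    have h2 : Tendsto (fun t => (A t *ᵥ F t) x) U (𝓝 (((l 0 : ℂ) • g) x)) := by
      simp only [hF2, Pi.smul_apply, smul_eq_mul]
      exact hlc.mul (hFx x)
    exact tendsto_nhds_unique h1 h2
  have hg0 : g ≠ 0 := by
    rintro rfl
    simp at hgS
  obtain ⟨c, hc⟩ : ∃ c : ℂ, c • f = g := by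
    have hfm : f ∈ Module.End.eigenspace (A 0).mulVecLin (l 0 : ℂ) :=
      Module.End.mem_eigenspace_iff.2 hf
    have hgm : g ∈ Module.End.eigenspace (A 0).mulVecLin (l 0 : ℂ) :=
      Module.End.mem_eigenspace_iff.2 hgeig
    obtain ⟨c, hc⟩ := exists_smul_eq_of_finrank_eq_one hs
      (x := ⟨f, hfm⟩) (by simpa [Subtype.ext_iff] using hf0) ⟨g, hgm⟩
    exact ⟨c, congrArg Subtype.val hc⟩
  have hc0 : c ≠ 0 := by
    rintro rfl
    exact hg0 (by rw [← hc, zero_smul])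
  have hadj : ∀ w, star f ⬝ᵥ (A 0 *ᵥ w) = (l 0 : ℂ) * (star f ⬝ᵥ w) := by
    intro w
    rw [Matrix.dotProduct_mulVec]
    have : star f ᵥ* A 0 = (l 0 : ℂ) • star f := by
      have h := congrArg star hf
      rw [Matrix.star_mulVec, herm.eq] at h
      rw [h, star_smul]
      simp
    rw [this, smul_dotProduct, smul_eq_mul]
  have hid : ∀ t, star f ⬝ᵥ ((Matrix.of fun x y => slope (fun t => A t x y) 0 t) *ᵥ F t)
      = (slope l 0 t : ℂ) * (star f ⬝ᵥ F t) := by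
    intro t
    have e : (Matrix.of fun x y => slope (fun t => A t x y) 0 t)
        = ((t⁻¹ : ℝ) : ℂ) • (A t - A 0) := by
      ext x y
      simp [slope_def_module]
    rw [e, Matrix.smul_mulVec, Matrix.sub_mulVec, dotProduct_smul, dotProduct_sub, hadj, hF2,
      dotProduct_smul, slope_def_module]
    simp
    ring
  have hL : Tendsto (fun t => star f ⬝ᵥ
      ((Matrix.of fun x y => slope (fun t => A t x y) 0 t) *ᵥ F t)) U
      (𝓝 (star f ⬝ᵥ (A' *ᵥ g))) := by
    simp only [Matrix.mulVec, dotProduct, Matrix.of_apply]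
    exact tendsto_finsetSum _ (fun x _ => tendsto_const_nhds.mul
      (tendsto_finsetSum _ (fun y _ =>
        ((hasDerivAt_iff_tendsto_slope.1 (hA x y)).mono_left hU).mul (hFx y))))
  have hR : Tendsto (fun t => (slope l 0 t : ℂ) * (star f ⬝ᵥ F t)) U
      (𝓝 ((l' : ℂ) * (star f ⬝ᵥ g))) := by
    refine Tendsto.mul ((Complex.continuous_ofReal.tendsto _).comp
      ((hasDerivAt_iff_tendsto_slope.1 hl).mono_left hU)) ?_
    simp only [dotProduct]
    exact tendsto_finsetSum _ (fun x _ => tendsto_const_nhds.mul (hFx x))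
  simp only [hid] at hL
  have key := tendsto_nhds_unique hL hR
  rw [← hc, Matrix.mulVec_smul, dotProduct_smul, dotProduct_smul, smul_eq_mul, smul_eq_mul] at key
  apply mul_left_cancel₀ hc0
  rw [key]; ring

theorem magH_herm {V : Type*} [Fintype V] [DecidableEq V]
    (G : SimpleGraph V) [DecidableRel G.Adj] (q : V → ℝ) {k : ℕ}
    (v u : Fin k → V) (α : Fin k → ℝ) : (magH G q v u α).IsHermitian := by
  ext x y
  have h1 : (Matrix.diagonal (fun x => (q x : ℂ))).IsHermitian := by
    apply Matrix.isHermitian_diagonal_of_self_adjoint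
    ext x; simp
  have h2 : (G.adjMatrix ℂ).IsHermitian := by
    ext x y
    simp [SimpleGraph.adjMatrix_apply, G.adj_comm, apply_ite]
  have h3 : (magM v u α).IsHermitian := by
    ext x y
    simp only [magM, Matrix.conjTranspose_apply, star_add, star_sum, apply_ite star, star_zero]
    rw [add_comm]
    congr 1 <;>
    · refine Finset.sum_congr rfl fun j _ => ?_
      simp only [and_comm]
      congr 1
      simp [← Complex.exp_conj]
  exact congrFun (congrFun ((h1.sub h2).sub h3) x) y

theorem magH_deriv {V : Type*} [Fintype V] [DecidableEq V]
    (G : SimpleGraph V) [DecidableRel G.Adj] (q : V → ℝ) {k : ℕ}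
    (v u : Fin k → V) (α : Fin k → ℝ) (j : Fin k) (x y : V) :
    HasDerivAt (fun t : ℝ => magH G q v u (α + t • Pi.single j 1) x y)
      (-((if x = v j ∧ y = u j then Complex.I * Complex.exp (Complex.I * α j) else 0) +
        (if x = u j ∧ y = v j then -Complex.I * Complex.exp (-(Complex.I * α j)) else 0))) 0 := by
  have hlin : ∀ i : Fin k, HasDerivAt
      (fun t : ℝ => Complex.I * (((α + t • (Pi.single j 1 : Fin k → ℝ)) i : ℝ) : ℂ))
      (if i = j then Complex.I else 0) 0 := by
    intro i
    have h : HasDerivAt (fun t : ℝ => (α + t • (Pi.single j 1 : Fin k → ℝ)) i)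
        ((Pi.single j 1 : Fin k → ℝ) i) 0 := by
      simpa using ((hasDerivAt_id (0:ℝ)).mul_const ((Pi.single j 1 : Fin k → ℝ) i)).const_add (α i)
    have h2 := h.ofReal_comp.const_mul Complex.I
    refine h2.congr_deriv ?_
    by_cases hij : i = j
    · subst hij; simp
    · simp [hij]
  have hM : HasDerivAt (fun t : ℝ => magM v u (α + t • Pi.single j 1) x y)
      ((∑ i, if i = j then (if x = v i ∧ y = u i then
          Complex.I * Complex.exp (Complex.I * α i) else 0) else 0) +
        ∑ i, if i = j then (if x = u i ∧ y = v i then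
          -Complex.I * Complex.exp (-(Complex.I * α i)) else 0) else 0) 0 := by
    unfold magM
    refine HasDerivAt.add (HasDerivAt.fun_sum fun i _ => ?_) (HasDerivAt.fun_sum fun i _ => ?_)
    · by_cases hxy : x = v i ∧ y = u i
      · simp only [hxy, and_self, if_true]
        refine (hlin i).cexp.congr_deriv ?_
        by_cases hij : i = j <;> simp [hij, mul_comm]
      · simp only [hxy, if_false, ite_self]
        exact hasDerivAt_const _ _
    · by_cases hxy : x = u i ∧ y = v i
      · simp only [hxy, and_self, if_true]
        refine (hlin i).fun_neg.cexp.congr_deriv ?_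
        by_cases hij : i = j <;> simp [hij, mul_comm]
      · simp only [hxy, if_false, ite_self]
        exact hasDerivAt_const _ _
  rw [Finset.sum_ite_eq' Finset.univ j, Finset.sum_ite_eq' Finset.univ j] at hM
  simp only [Finset.mem_univ, if_true] at hM
  simp only [magH, Matrix.sub_apply]
  exact hM.const_sub _

/-- **Hellmann–Feynman formula (discrete).** If `λ(α)` is an eigenvalue of `H^α` for all
`α`, `λ` is differentiable at `α*`, the eigenvalue `λ(α*)` is simple, and `f` is a
corresponding unit-norm eigenvector, then
`∂λ/∂α_j (α*) = 2 Im (e^{iα*_j} f(u_j) conj (f(v_j)))`. -/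
theorem hellmann_feynman_discrete
    {V : Type*} [Fintype V] [DecidableEq V]
    (G : SimpleGraph V) [DecidableRel G.Adj] (q : V → ℝ) {k : ℕ}
    (v u : Fin k → V)
    (hdist : Function.Injective (Sum.elim v u : Fin k ⊕ Fin k → V))
    (hnoedge : ∀ j, ¬ G.Adj (v j) (u j))
    (lam : (Fin k → ℝ) → ℝ)
    (hlam : ∀ α, Module.End.HasEigenvalue (magH G q v u α).mulVecLin (lam α : ℂ))
    (αs : Fin k → ℝ)
    (hdiff : DifferentiableAt ℝ lam αs)
    (hsimple : Module.finrank ℂ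
      (Module.End.eigenspace (magH G q v u αs).mulVecLin (lam αs : ℂ)) = 1)
    (f : V → ℂ)
    (hf : (magH G q v u αs).mulVec f = (lam αs : ℂ) • f)
    (hnorm : ∑ x, Complex.normSq (f x) = 1) :
    ∀ j, fderiv ℝ lam αs (Pi.single j 1)
      = 2 * (Complex.exp (Complex.I * αs j) * f (u j) * (starRingEnd ℂ) (f (v j))).im := by
  intro j
  have hf0 : f ≠ 0 := by
    rintro rfl
    simp at hnorm
  have hl : HasDerivAt (fun t : ℝ => lam (αs + t • Pi.single j 1))
      (fderiv ℝ lam αs (Pi.single j 1)) 0 :=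
    hdiff.hasFDerivAt.hasLineDerivAt (Pi.single j 1)
  have key := hf_general (fun t : ℝ => magH G q v u (αs + t • Pi.single j 1))
    (Matrix.of fun x y =>
      (-((if x = v j ∧ y = u j then Complex.I * Complex.exp (Complex.I * αs j) else 0) +
        (if x = u j ∧ y = v j then -Complex.I * Complex.exp (-(Complex.I * αs j)) else 0))))
    (fun x y => magH_deriv G q v u αs j x y) _ _ hl (magH_herm _ _ _ _ _)
    (fun t => hlam _) (by
      have e : αs + (0:ℝ) • (Pi.single j 1 : Fin k → ℝ) = αs := by rw [zero_smul, add_zero]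
      beta_reduce
      rw [e]; exact hsimple) f (by simpa using hf) hf0
  have hn : star f ⬝ᵥ f = 1 := by
    have : star f ⬝ᵥ f = ((∑ x, Complex.normSq (f x) : ℝ) : ℂ) := by
      simp [dotProduct, Complex.normSq_eq_conj_mul_self]
    rw [this, hnorm]; simp
  rw [hn, mul_one] at key
  have hq : star f ⬝ᵥ ((Matrix.of fun x y =>
      (-((if x = v j ∧ y = u j then Complex.I * Complex.exp (Complex.I * αs j) else 0) +
        (if x = u j ∧ y = v j then -Complex.I * Complex.exp (-(Complex.I * αs j)) else 0)))) *ᵥ f)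
      = -(star (f (v j)) * (Complex.I * Complex.exp (Complex.I * αs j) * f (u j)) +
        star (f (u j)) * (-Complex.I * Complex.exp (-(Complex.I * αs j)) * f (v j))) := by
    simp only [dotProduct, Matrix.mulVec, Matrix.of_apply, ite_and, Pi.star_apply, neg_mul,
      Finset.sum_neg_distrib, mul_neg, add_mul, Finset.sum_add_distrib, mul_add, ite_mul, zero_mul]
    simp [Finset.sum_ite_irrel, neg_mul]
  rw [hq] at key
  set z := Complex.exp (Complex.I * αs j) * f (u j) * (starRingEnd ℂ) (f (v j)) with hz
  have hzc : (starRingEnd ℂ) z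
      = Complex.exp (-(Complex.I * αs j)) * star (f (u j)) * f (v j) := by
    simp [hz, ← Complex.exp_conj]
  have h3 : ((fderiv ℝ lam αs (Pi.single j 1) : ℝ) : ℂ)
      = -(Complex.I * z - Complex.I * (starRingEnd ℂ) z) := by
    rw [← key, hzc, hz, starRingEnd_apply]; ring
  have h4 := congrArg Complex.re h3
  simp at h4
  rw [h4]; ring
end
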